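/- arXiv:2502.11467 — 3 statements merged into one kernel-verified Lean document; each statement's English description precedes it below -/
import Mathlib

section
/- Let N, L ∈ ℕ₊ and let Φ : ℝ^{d_0} → ℝ be a ReLU feed-forward neural network of width N and depth L such that for all inputs under consideration, the input vector, the output, and all hidden-layer values of Φ are nonnegative. Then there exists a composition of L feed-forward layers of width 2N (a Transformer network consisting only of feed-forward layers, acting on matrices with 2N rows) which computes Φ: for each admissible input x₀, placing x₀ in the top d_0 entries of an input column (with zeros elsewhere), a designated entry of the corresponding output column equals Φ(x₀). -/
open scoped Matrix

/-- Entrywise ReLU. -/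
def relu (x : ℝ) : ℝ := max 0 x

/-- Entrywise ReLU on matrices. -/
def reluM {a b : ℕ} (X : Matrix (Fin a) (Fin b) ℝ) : Matrix (Fin a) (Fin b) ℝ :=
  Matrix.of fun i j => relu (X i j)

/-- The parameters of a feed-forward layer on `ℝ^{d×·}` with inner dimension `r`. -/
structure FFLayer (d : ℕ) where
  r : ℕ
  W1 : Matrix (Fin r) (Fin d) ℝ
  W2 : Matrix (Fin d) (Fin r) ℝ
  b1 : Fin r → ℝ
  b2 : Fin d → ℝ

/-- `FF(X) = X + W₂ · ReLU(W₁ X + b₁ 1ₙ^⊤) + b₂ 1ₙ^⊤`. -/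
def FFLayer.apply {d : ℕ} (F : FFLayer d) {n : ℕ}
    (X : Matrix (Fin d) (Fin n) ℝ) : Matrix (Fin d) (Fin n) ℝ :=
  X + F.W2 * reluM (F.W1 * X + Matrix.of fun i _ => F.b1 i) +
    Matrix.of fun i _ => F.b2 i

/-- Applying a composition of feed-forward layers (a Transformer network all of
whose attention layers are the identity map). -/
def applyFFNet {d : ℕ} (net : List (FFLayer d)) {n : ℕ}
    (X : Matrix (Fin d) (Fin n) ℝ) : Matrix (Fin d) (Fin n) ℝ :=
  net.foldl (fun Y F => F.apply Y) X

/-- Embed a `d × n` matrix into the top-left block of a `d' × n'` matrix,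
filling the remaining entries with zeros. -/
def embed {d n : ℕ} (d' n' : ℕ) (X : Matrix (Fin d) (Fin n) ℝ) :
    Matrix (Fin d') (Fin n') ℝ :=
  Matrix.of fun i j =>
    if h : (i : ℕ) < d ∧ (j : ℕ) < n then X ⟨i, h.1⟩ ⟨j, h.2⟩ else 0

/-- A ReLU feed-forward neural network `ℝ^{d₀} → ℝ`: depth `L`, layer dimensions
`dims i` (with `dims 0 = d₀` and `dims (L+1) = 1`), affine maps `W i, b i`. -/
structure ReLUFNN (d0 : ℕ) where
  L : ℕ
  dims : ℕ → ℕ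
  W : (i : ℕ) → Matrix (Fin (dims (i+1))) (Fin (dims i)) ℝ
  b : (i : ℕ) → Fin (dims (i+1)) → ℝ
  dim0 : dims 0 = d0
  dimLast : dims (L+1) = 1

/-- The hidden layers of a ReLU FNN: `x₀` is the input and
`x_{i+1} = ReLU(W_i x_i + b_i)`. -/
def ReLUFNN.hidden {d0 : ℕ} (Φ : ReLUFNN d0) (x0 : Fin d0 → ℝ) :
    (i : ℕ) → Fin (Φ.dims i) → ℝ
  | 0 => fun j => x0 (Fin.cast Φ.dim0 j)
  | (i+1) => fun j => relu ((Φ.W i).mulVec (Φ.hidden x0 i) j + Φ.b i j)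

/-- The output of a ReLU FNN: `y = W_L x_L + b_L` (no activation after the final
affine map). -/
def ReLUFNN.output {d0 : ℕ} (Φ : ReLUFNN d0) (x0 : Fin d0 → ℝ) : ℝ :=
  ((Φ.W Φ.L).mulVec (Φ.hidden x0 Φ.L) + Φ.b Φ.L) (Fin.cast Φ.dimLast.symm 0)

theorem relu_of_nonneg {x : ℝ} (hx : 0 ≤ x) : relu x = x := max_eq_right hx

theorem relu_nonneg (x : ℝ) : 0 ≤ relu x := le_max_left _ _

/-- The matrix of the inclusion of the first `k` coordinates into `D` coordinates. -/
def inclusionMatrix (D k : ℕ) : Matrix (Fin D) (Fin k) ℝ :=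
  Matrix.of fun i j => if (i : ℕ) = j then 1 else 0

theorem inclusionMatrix_transpose_mul_self {D k : ℕ} (h : k ≤ D) :
    (inclusionMatrix D k)ᵀ * inclusionMatrix D k = 1 := by
  ext i j
  rw [Matrix.mul_apply, Finset.sum_eq_single (Fin.castLE h i)]
  · simp [inclusionMatrix, Matrix.one_apply, Fin.ext_iff]
  · intro l _ hl
    have : (l : ℕ) ≠ i := fun e => hl (Fin.ext e)
    simp [inclusionMatrix, this]
  · simp

theorem embed_eq_inclusionMatrix_mul {D k n : ℕ} (X : Matrix (Fin k) (Fin n) ℝ) :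
    embed D n X = inclusionMatrix D k * X := by
  ext i j
  rw [Matrix.mul_apply]
  by_cases hi : (i : ℕ) < k
  · rw [Finset.sum_eq_single ⟨i, hi⟩]
    · simp [embed, inclusionMatrix, hi]
    · intro l _ hl
      have : (i : ℕ) ≠ l := fun e => hl (Fin.ext e.symm)
      simp [inclusionMatrix, this]
    · simp
  · rw [Finset.sum_eq_zero]
    · simp [embed, hi]
    · intro l _
      have : (i : ℕ) ≠ l := fun e => hi (e ▸ l.2)
      simp [inclusionMatrix, this]

/-- A feed-forward layer replacing `X` by `C * ReLU(A X + a) + c` in the top rows. The last `k`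
inner neurons copy the (nonnegative) input, which is then cancelled against the skip connection. -/
def replacementLayer (D : ℕ) {k m p : ℕ} (A : Matrix (Fin m) (Fin k) ℝ) (a : Fin m → ℝ)
    (C : Matrix (Fin p) (Fin m) ℝ) (c : Fin p → ℝ) : FFLayer D where
  r := m + k
  W1 := (Matrix.fromRows (A * (inclusionMatrix D k)ᵀ) (inclusionMatrix D k)ᵀ).submatrix
    finSumFinEquiv.symm id
  W2 := (Matrix.fromCols (inclusionMatrix D p * C) (-inclusionMatrix D k)).submatrix
    id finSumFinEquiv.symm
  b1 := fun i => Sum.elim a 0 (finSumFinEquiv.symm i)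
  b2 := (inclusionMatrix D p).mulVec c

theorem replacementLayer_apply_embed {D k m p n : ℕ} (hk : k ≤ D)
    (A : Matrix (Fin m) (Fin k) ℝ) (a : Fin m → ℝ)
    (C : Matrix (Fin p) (Fin m) ℝ) (c : Fin p → ℝ)
    (X : Matrix (Fin k) (Fin n) ℝ) (hX : ∀ i j, 0 ≤ X i j) :
    (replacementLayer D A a C c).apply (embed D n X) =
      embed D n (C * reluM (A * X + Matrix.of fun i _ => a i) + Matrix.of fun i _ => c i) := by
  have hcopy : (inclusionMatrix D k)ᵀ * (inclusionMatrix D k * X) = X := by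
    rw [← Matrix.mul_assoc, inclusionMatrix_transpose_mul_self hk, Matrix.one_mul]
  have hW : (Matrix.fromRows (A * (inclusionMatrix D k)ᵀ) (inclusionMatrix D k)ᵀ).submatrix
      finSumFinEquiv.symm id * (inclusionMatrix D k * X) =
      (Matrix.fromRows (A * X) X).submatrix (finSumFinEquiv (m := m) (n := k)).symm id := by
    have h : Matrix.fromRows (A * (inclusionMatrix D k)ᵀ) (inclusionMatrix D k)ᵀ *
        (inclusionMatrix D k * X) = Matrix.fromRows (A * X) X := by
      rw [Matrix.fromRows_mul, Matrix.mul_assoc A, hcopy]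
    rw [← h]
    rfl
  have hinner : reluM ((Matrix.fromRows (A * X) X).submatrix
        (finSumFinEquiv (m := m) (n := k)).symm id +
        Matrix.of fun i _ => Sum.elim a 0 (finSumFinEquiv.symm i)) =
      (Matrix.fromRows (reluM (A * X + Matrix.of fun i _ => a i)) X).submatrix
        finSumFinEquiv.symm id := by
    ext i j
    obtain ⟨i, rfl⟩ := finSumFinEquiv.surjective i
    simp only [reluM, Matrix.of_apply, Matrix.add_apply, Matrix.submatrix_apply,
      Equiv.symm_apply_apply, id]
    cases i with
    | inl i => simp
    | inr i => simp [relu_of_nonneg (hX _ _)]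
  have h : embed D n X + (Matrix.fromCols (inclusionMatrix D p * C) (-inclusionMatrix D k)).submatrix
      id (finSumFinEquiv (m := m) (n := k)).symm * reluM
        ((Matrix.fromRows (A * (inclusionMatrix D k)ᵀ) (inclusionMatrix D k)ᵀ).submatrix
          finSumFinEquiv.symm id * embed D n X +
        Matrix.of fun i _ => Sum.elim a 0 (finSumFinEquiv.symm i)) +
      inclusionMatrix D p * Matrix.of (fun i _ => c i) =
      embed D n (C * reluM (A * X + Matrix.of fun i _ => a i) + Matrix.of fun i _ => c i) := by
    rw [embed_eq_inclusionMatrix_mul, embed_eq_inclusionMatrix_mul, hW, hinner,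
      Matrix.submatrix_mul_equiv, Matrix.submatrix_id_id, Matrix.fromCols_mul_fromRows,
      Matrix.neg_mul, Matrix.mul_assoc, Matrix.mul_add]
    abel
  exact h

theorem applyFFNet_append_singleton {d n : ℕ} (net : List (FFLayer d)) (F : FFLayer d)
    (X : Matrix (Fin d) (Fin n) ℝ) : applyFFNet (net ++ [F]) X = F.apply (applyFFNet net X) := by
  simp [applyFFNet]

namespace ReLUFNN

variable {d0 : ℕ} (Φ : ReLUFNN d0)

theorem hidden_nonneg {x0 : Fin d0 → ℝ} (hx : ∀ j, 0 ≤ x0 j) (i : ℕ) (j : Fin (Φ.dims i)) :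
    0 ≤ Φ.hidden x0 i j := by
  cases i with
  | zero => exact hx _
  | succ i => exact relu_nonneg _

theorem embed_hidden_zero (D : ℕ) (x0 : Fin d0 → ℝ) :
    embed D 1 (Matrix.of fun i (_ : Fin 1) => Φ.hidden x0 0 i) =
      embed D 1 (Matrix.of fun i (_ : Fin 1) => x0 i) := by
  ext i j
  simp [embed, hidden, Φ.dim0]

theorem exists_ffNet_hidden {N : ℕ} (i : ℕ) (hN : ∀ j ≤ i, Φ.dims j ≤ N) :
    ∃ net : List (FFLayer (2 * N)), net.length = i ∧ (∀ F ∈ net, F.r ≤ 2 * N) ∧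
      ∀ x0 : Fin d0 → ℝ, (∀ j, 0 ≤ x0 j) →
        applyFFNet net (embed (2 * N) 1 (Matrix.of fun i (_ : Fin 1) => x0 i)) =
          embed (2 * N) 1 (Matrix.of fun j (_ : Fin 1) => Φ.hidden x0 i j) := by
  induction i with
  | zero => exact ⟨[], rfl, by simp, fun x0 _ => (Φ.embed_hidden_zero _ x0).symm⟩
  | succ i ih =>
    obtain ⟨net, hlen, hr, hnet⟩ := ih fun j hj => hN j (by omega)
    have h₁ := hN i (by omega)
    have h₂ := hN (i + 1) le_rfl
    refine ⟨net ++ [replacementLayer _ (Φ.W i) (Φ.b i) (1 : Matrix (Fin (Φ.dims (i + 1))) _ ℝ) 0],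
      by simp [hlen], ?_, ?_⟩
    · intro F hF
      rcases List.mem_append.1 hF with hF | hF
      · exact hr F hF
      · rw [List.mem_singleton.1 hF]
        change Φ.dims (i + 1) + Φ.dims i ≤ 2 * N
        omega
    · intro x0 hx
      rw [applyFFNet_append_singleton, hnet x0 hx, replacementLayer_apply_embed (by omega) _ _ _ _
        (Matrix.of fun j _ => Φ.hidden x0 i j) fun j _ => Φ.hidden_nonneg hx i j, Matrix.one_mul]
      congr 1
      ext j l
      exact add_zero _

end ReLUFNN

/-- A ReLU FNN of width `N` and depth `L`, all of whose inputs, outputs and hidden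
values are nonnegative on the admissible inputs `S`, can be computed by a
composition of `L` feed-forward layers of width `2N`: placing the input in the top
`d₀` entries of an input column (zeros elsewhere), a designated entry of the output
column equals the output of the FNN. -/
theorem stmt8 (N L d0 : ℕ) (hN : 0 < N) (hL : 0 < L) (hd0 : d0 ≤ N)
    (Φ : ReLUFNN d0) (hdepth : Φ.L = L)
    (hwidth : ∀ i, 1 ≤ i → i ≤ Φ.L → Φ.dims i ≤ N)
    (S : Set (Fin d0 → ℝ))
    (hnonneg : ∀ x0 ∈ S, (∀ j, 0 ≤ x0 j) ∧ 0 ≤ Φ.output x0 ∧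
      ∀ i, 1 ≤ i → i ≤ Φ.L → ∀ j, 0 ≤ Φ.hidden x0 i j) :
    ∃ (net : List (FFLayer (2*N))) (i0 : Fin (2*N)),
      net.length = L ∧
      (∀ F ∈ net, F.r ≤ 2*N) ∧
      ∀ x0 ∈ S,
        applyFFNet net (embed (2*N) 1 (Matrix.of fun i (_ : Fin 1) => x0 i)) i0 0 =
          Φ.output x0 := by
  subst hdepth
  obtain ⟨l, hl⟩ := Nat.exists_eq_add_of_lt hL
  rw [zero_add] at hl
  have hdims : ∀ j ≤ Φ.L, Φ.dims j ≤ N := fun j hj => by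
    rcases Nat.eq_zero_or_pos j with rfl | hj0
    · exact Φ.dim0.trans_le hd0
    · exact hwidth j hj0 hj
  obtain ⟨net, hlen, hr, hnet⟩ := Φ.exists_ffNet_hidden l fun j hj => hdims j (by omega)
  have h₁ := hdims l (by omega)
  have h₂ := hdims (l + 1) (by omega)
  refine ⟨net ++ [replacementLayer _ (Φ.W l) (Φ.b l) (Φ.W (l + 1)) (Φ.b (l + 1))],
    ⟨0, by omega⟩, by simp [hlen, hl], ?_, ?_⟩
  · intro F hF
    rcases List.mem_append.1 hF with hF | hF
    · exact hr F hF
    · rw [List.mem_singleton.1 hF]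
      change Φ.dims (l + 1) + Φ.dims l ≤ 2 * N
      omega
  · intro x0 hx0
    have hx := (hnonneg x0 hx0).1
    rw [applyFFNet_append_singleton, hnet x0 hx, replacementLayer_apply_embed (by omega) _ _ _ _
      (Matrix.of fun j _ => Φ.hidden x0 l j) fun j _ => Φ.hidden_nonneg hx l j]
    have hlast : 0 < Φ.dims (l + 1 + 1) := by
      rw [← hl, Φ.dimLast]
      exact one_pos
    have hout : Φ.output x0 = ((Φ.W (l + 1)).mulVec (Φ.hidden x0 (l + 1)) + Φ.b (l + 1))
        ⟨0, hlast⟩ := by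
      have key : ∀ (m : ℕ) (hm : Φ.L = m) (h : 0 < Φ.dims (m + 1)), Φ.output x0 =
          ((Φ.W m).mulVec (Φ.hidden x0 m) + Φ.b m) ⟨0, h⟩ := by
        rintro m rfl h
        rfl
      exact key _ hl hlast
    rw [hout]
    simp only [embed, Matrix.of_apply, Fin.val_zero, hlast, zero_lt_one, and_self, dite_true]
    rfl
end

section
/- For every integer m ≥ 1 and all x, y ∈ [0,1], one has −4^{−(m+1)} ≤ g̃_m(x,y) − xy ≤ 2^{−(2m+1)}. Consequently, if k, L, N ∈ ℕ₊ satisfy 2^k ≤ N < 2^{k+1}, then |g̃_{Lk}(x,y) − xy| < N^{−L} for all x, y ∈ [0,1]. -/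
/-- The tent (sawtooth) map `T₁`. -/
noncomputable def T1 (x : ℝ) : ℝ := if x ≤ 1/2 then 2*x else 2*(1-x)

/-- `f̃_k(x) = x − Σ_{i=1}^k T_i(x)/4^i`, where `T_i = T₁^[i]`. -/
noncomputable def ftilde (k : ℕ) (x : ℝ) : ℝ :=
  x - ∑ i ∈ Finset.range k, T1^[i+1] x / 4^(i+1)

/-- `g̃_m(x,y) := 2 f̃_m((x+y)/2) − (1/2) f̃_m(x) − (1/2) f̃_m(y)`. -/
noncomputable def gtilde (m : ℕ) (x y : ℝ) : ℝ :=
  2 * ftilde m ((x+y)/2) - (1/2) * ftilde m x - (1/2) * ftilde m y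

theorem T1_mem_Icc {x : ℝ} (hx : x ∈ Set.Icc (0:ℝ) 1) : T1 x ∈ Set.Icc (0:ℝ) 1 := by
  obtain ⟨h0, h1⟩ := hx
  unfold T1
  split_ifs <;> constructor <;> linarith

theorem T1_mul_one_sub (x : ℝ) : T1 x * (1 - T1 x) = 4 * (x * (1 - x)) - T1 x := by
  unfold T1
  split_ifs <;> ring

theorem ftilde_sub_sq (k : ℕ) (x : ℝ) :
    ftilde k x - x^2 = T1^[k] x * (1 - T1^[k] x) / 4^k := by
  induction k with
  | zero => simp [ftilde]; ring
  | succ k ih =>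
    have hsucc : ftilde (k+1) x = ftilde k x - T1^[k+1] x / 4^(k+1) := by
      simp only [ftilde, Finset.sum_range_succ]
      ring
    have hpow : (4:ℝ)^k ≠ 0 := by positivity
    rw [hsucc, sub_right_comm, ih, Function.iterate_succ_apply', T1_mul_one_sub, pow_succ]
    field_simp

theorem ftilde_sub_sq_mem_Icc (k : ℕ) {x : ℝ} (hx : x ∈ Set.Icc (0:ℝ) 1) :
    ftilde k x - x^2 ∈ Set.Icc (0:ℝ) (1 / 4^(k+1)) := by
  have hmaps : Set.MapsTo T1 (Set.Icc (0:ℝ) 1) (Set.Icc (0:ℝ) 1) := fun _ => T1_mem_Icc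
  obtain ⟨h0, h1⟩ := hmaps.iterate k hx
  rw [ftilde_sub_sq]
  constructor
  · have := sub_nonneg.2 h1
    positivity
  · rw [pow_succ', ← div_div]
    gcongr
    nlinarith [sq_nonneg (2 * T1^[k] x - 1)]

theorem gtilde_sub_mul_bounds (m : ℕ) {x y : ℝ} (hx : x ∈ Set.Icc (0:ℝ) 1)
    (hy : y ∈ Set.Icc (0:ℝ) 1) :
    -(1 / 4^(m+1)) ≤ gtilde m x y - x*y ∧ gtilde m x y - x*y ≤ 1 / 2^(2*m+1) := by
  have hxy : (x+y)/2 ∈ Set.Icc (0:ℝ) 1 :=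
    ⟨by linarith [hx.1, hy.1], by linarith [hx.2, hy.2]⟩
  obtain ⟨hx0, hx1⟩ := ftilde_sub_sq_mem_Icc m hx
  obtain ⟨hy0, hy1⟩ := ftilde_sub_sq_mem_Icc m hy
  obtain ⟨hxy0, hxy1⟩ := ftilde_sub_sq_mem_Icc m hxy
  have hpow : (1:ℝ) / 2^(2*m+1) = 2 * (1 / 4^(m+1)) := by
    rw [pow_succ, pow_mul, pow_succ]
    norm_num
    ring
  rw [hpow]
  unfold gtilde
  constructor <;> linarith

/-- For every `m ≥ 1` and `x,y ∈ [0,1]`, `−4^{−(m+1)} ≤ g̃_m(x,y) − xy ≤ 2^{−(2m+1)}`;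
consequently if `2^k ≤ N < 2^(k+1)` then `|g̃_{Lk}(x,y) − xy| < N^{−L}` on `[0,1]²`. -/
theorem stmt9 :
    (∀ m : ℕ, 1 ≤ m → ∀ x y : ℝ, x ∈ Set.Icc (0:ℝ) 1 → y ∈ Set.Icc (0:ℝ) 1 →
      -(1 / 4^(m+1)) ≤ gtilde m x y - x*y ∧ gtilde m x y - x*y ≤ 1 / 2^(2*m+1)) ∧
    (∀ k L N : ℕ, 0 < k → 0 < L → 0 < N → 2^k ≤ N → N < 2^(k+1) →
      ∀ x y : ℝ, x ∈ Set.Icc (0:ℝ) 1 → y ∈ Set.Icc (0:ℝ) 1 →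
        |gtilde (L*k) x y - x*y| < 1 / (N : ℝ)^L) := by
  refine ⟨fun m _ x y hx hy => gtilde_sub_mul_bounds m hx hy, ?_⟩
  intro k L N hk _ hN _ hNk x y hx hy
  obtain ⟨hlow, hupp⟩ := gtilde_sub_mul_bounds (L*k) hx hy
  have hN' : (0:ℝ) < N := by exact_mod_cast hN
  have hpow : (N:ℝ)^L < 2^(2*(L*k)+1) := by
    calc (N:ℝ)^L ≤ (2^(k+1))^L := by
          gcongr
          exact_mod_cast hNk.le
      _ = 2^((k+1)*L) := (pow_mul _ _ _).symm
      _ < 2^(2*(L*k)+1) := pow_lt_pow_right₀ one_lt_two (by nlinarith)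
  have hinv : (1:ℝ) / 2^(2*(L*k)+1) < 1 / (N:ℝ)^L :=
    one_div_lt_one_div_of_lt (by positivity) hpow
  have hle : (1:ℝ) / 4^(L*k+1) ≤ 1 / 2^(2*(L*k)+1) := by
    apply one_div_le_one_div_of_le (by positivity)
    rw [show (4:ℝ) = 2^2 by norm_num, ← pow_mul]
    exact pow_le_pow_right₀ one_le_two (by omega)
  exact abs_lt.2 ⟨by linarith, by linarith⟩
end

section
/- For every integer m ≥ 1 and all x, y ∈ [0,1], one has g̃_m(x,y) ≤ f̃_m((x+y)/2) ≤ 1; consequently the function h̃_m(x,y) := max(0, g̃_m(x,y)) satisfies 0 ≤ h̃_m(x,y) ≤ 1 for all x, y ∈ [0,1]. -/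
theorem ftilde_succ (k : ℕ) (x : ℝ) :
    ftilde (k + 1) x = x - T1 x / 2 + ftilde k (T1 x) / 4 := by
  have h : ∀ i, T1^[i + 1 + 1] x / 4 ^ (i + 1 + 1) = T1^[i + 1] (T1 x) / 4 ^ (i + 1) / 4 := by
    intro i
    rw [Function.iterate_succ_apply, pow_succ (4 : ℝ) (i + 1), div_div]
  simp only [ftilde]
  rw [Finset.sum_range_succ', Finset.sum_congr rfl fun i _ => h i, ← Finset.sum_div]
  simp only [zero_add, Function.iterate_one, pow_one]
  ring

theorem ftilde_succ_of_le (k : ℕ) {x : ℝ} (h : x ≤ 1 / 2) :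
    ftilde (k + 1) x = ftilde k (2 * x) / 4 := by
  rw [ftilde_succ, T1, if_pos h]
  ring

theorem ftilde_succ_of_lt (k : ℕ) {x : ℝ} (h : 1 / 2 < x) :
    ftilde (k + 1) x = 2 * x - 1 + ftilde k (2 * (1 - x)) / 4 := by
  rw [ftilde_succ, T1, if_neg h.not_ge]
  ring

theorem ftilde_zero (x : ℝ) : ftilde 0 x = x := by
  simp [ftilde]

theorem ftilde_le_self (k : ℕ) : ∀ x ∈ Set.Icc (0 : ℝ) 1, ftilde k x ≤ x := by
  induction k with
  | zero => exact fun x _ => (ftilde_zero x).le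
  | succ k ih =>
    rintro x ⟨h0, h1⟩
    rcases le_or_gt x (1 / 2) with h | h
    · rw [ftilde_succ_of_le k h]
      linarith [ih (2 * x) ⟨by linarith, by linarith⟩]
    · rw [ftilde_succ_of_lt k h]
      linarith [ih (2 * (1 - x)) ⟨by linarith, by linarith⟩]

/-- The line through the points `(j / 2 ^ k, (j / 2 ^ k) ^ 2)` and
`((j + 1) / 2 ^ k, ((j + 1) / 2 ^ k) ^ 2)` of the parabola. -/
noncomputable def parabolaChord (k : ℕ) (j : ℤ) (x : ℝ) : ℝ :=
  (2 * j + 1) * x / 2 ^ k - j * (j + 1) / (2 ^ k) ^ 2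

theorem parabolaChord_succ (k : ℕ) (j : ℤ) (x : ℝ) :
    parabolaChord (k + 1) j x = parabolaChord k j (2 * x) / 4 := by
  simp only [parabolaChord, pow_succ (2 : ℝ) k]
  field_simp
  ring

theorem parabolaChord_succ_reflect (k : ℕ) (j : ℤ) (x : ℝ) :
    parabolaChord (k + 1) (2 ^ (k + 1) - 1 - j) x =
      2 * x - 1 + parabolaChord k j (2 * (1 - x)) / 4 := by
  simp only [parabolaChord]
  push_cast
  simp only [pow_succ (2 : ℝ) k]
  field_simp
  ring

theorem parabolaChord_midpoint (k : ℕ) (j : ℤ) (x y : ℝ) :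
    parabolaChord k j ((x + y) / 2) = (parabolaChord k j x + parabolaChord k j y) / 2 := by
  simp only [parabolaChord]
  ring

theorem parabolaChord_le_ftilde (k : ℕ) :
    ∀ (j : ℤ), ∀ x ∈ Set.Icc (0 : ℝ) 1, parabolaChord k j x ≤ ftilde k x := by
  induction k with
  | zero =>
    rintro j x ⟨h0, h1⟩
    simp only [ftilde_zero, parabolaChord, pow_zero, one_pow, div_one]
    rcases lt_trichotomy j 0 with h | rfl | h
    · have h' : (j : ℝ) ≤ -1 := by exact_mod_cast (by omega : j ≤ -1)
      nlinarith
    · simp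
    · have h' : (1 : ℝ) ≤ j := by exact_mod_cast (by omega : 1 ≤ j)
      nlinarith
  | succ k ih =>
    rintro j x ⟨h0, h1⟩
    rcases le_or_gt x (1 / 2) with h | h
    · rw [ftilde_succ_of_le k h, parabolaChord_succ]
      linarith [ih j (2 * x) ⟨by linarith, by linarith⟩]
    · have e := parabolaChord_succ_reflect k (2 ^ (k + 1) - 1 - j) x
      rw [sub_sub_cancel] at e
      rw [ftilde_succ_of_lt k h, e]
      linarith [ih (2 ^ (k + 1) - 1 - j) (2 * (1 - x)) ⟨by linarith, by linarith⟩]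

theorem exists_ftilde_eq_parabolaChord (k : ℕ) :
    ∀ x : ℝ, ∃ j : ℤ, ftilde k x = parabolaChord k j x := by
  induction k with
  | zero => exact fun x => ⟨0, by simp [ftilde_zero, parabolaChord]⟩
  | succ k ih =>
    intro x
    rcases le_or_gt x (1 / 2) with h | h
    · obtain ⟨j, hj⟩ := ih (2 * x)
      exact ⟨j, by rw [ftilde_succ_of_le k h, parabolaChord_succ, hj]⟩
    · obtain ⟨j, hj⟩ := ih (2 * (1 - x))
      exact ⟨2 ^ (k + 1) - 1 - j, by
        rw [ftilde_succ_of_lt k h, parabolaChord_succ_reflect, hj]⟩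

theorem ftilde_midpoint_le (k : ℕ) {x y : ℝ} (hx : x ∈ Set.Icc (0 : ℝ) 1)
    (hy : y ∈ Set.Icc (0 : ℝ) 1) :
    ftilde k ((x + y) / 2) ≤ (ftilde k x + ftilde k y) / 2 := by
  obtain ⟨j, hj⟩ := exists_ftilde_eq_parabolaChord k ((x + y) / 2)
  rw [hj, parabolaChord_midpoint]
  linarith [parabolaChord_le_ftilde k j x hx, parabolaChord_le_ftilde k j y hy]

/-- For every `m ≥ 1` and `x,y ∈ [0,1]`, `g̃_m(x,y) ≤ f̃_m((x+y)/2) ≤ 1`; consequently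
`h̃_m(x,y) := max(0, g̃_m(x,y))` satisfies `0 ≤ h̃_m(x,y) ≤ 1`. -/
theorem stmt10 (m : ℕ) (hm : 1 ≤ m) (x y : ℝ)
    (hx : x ∈ Set.Icc (0:ℝ) 1) (hy : y ∈ Set.Icc (0:ℝ) 1) :
    gtilde m x y ≤ ftilde m ((x+y)/2) ∧ ftilde m ((x+y)/2) ≤ 1 ∧
    0 ≤ max 0 (gtilde m x y) ∧ max 0 (gtilde m x y) ≤ 1 := by
  have hg : gtilde m x y ≤ ftilde m ((x + y) / 2) := by
    rw [gtilde]
    linarith [ftilde_midpoint_le m hx hy]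
  have hf : ftilde m ((x + y) / 2) ≤ 1 := by
    obtain ⟨hx0, hx1⟩ := hx
    obtain ⟨hy0, hy1⟩ := hy
    linarith [ftilde_le_self m ((x + y) / 2) ⟨by linarith, by linarith⟩]
  exact ⟨hg, hf, le_max_left _ _, max_le zero_le_one (hg.trans hf)⟩
end
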